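/- Let K ≥ 1, z : Fin K → ℝ, and 0 < τ₁ ≤ τ₂. Then H(softmax(fun i => z i / τ₁)) ≤ H(softmax(fun i => z i / τ₂)), where H(p) = -∑ i, p i · Real.log (p i) is the Shannon entropy. -/

import Mathlib

noncomputable def softmax {K : ℕ} (z : Fin K → ℝ) : Fin K → ℝ :=
  fun i => Real.exp (z i) / ∑ j, Real.exp (z j)

noncomputable def shannonEntropy {K : ℕ} (p : Fin K → ℝ) : ℝ :=
  -∑ i, p i * Real.log (p i)

/-- Gibbs' inequality for strictly positive weights of equal total mass. -/
theorem sum_mul_log_le_sum_mul_log_self {ι : Type*} [Fintype ι] {p q : ι → ℝ}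
    (hp : ∀ i, 0 < p i) (hq : ∀ i, 0 < q i) (h : ∑ i, p i = ∑ i, q i) :
    ∑ i, p i * Real.log (q i) ≤ ∑ i, p i * Real.log (p i) := by
  have key : ∀ i, p i * Real.log (q i) - p i * Real.log (p i) ≤ q i - p i := fun i => by
    have hlog := mul_le_mul_of_nonneg_left
      (Real.log_le_sub_one_of_pos (div_pos (hq i) (hp i))) (hp i).le
    rw [Real.log_div (hq i).ne' (hp i).ne', mul_sub, mul_sub,
      mul_div_cancel₀ _ (hp i).ne', mul_one] at hlog
    exact hlog
  have hsum := Finset.sum_le_sum fun i (_ : i ∈ Finset.univ) => key i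
  rw [Finset.sum_sub_distrib, Finset.sum_sub_distrib] at hsum
  linarith

section Softmax

variable {K : ℕ} [NeZero K] (z : Fin K → ℝ)

theorem sum_exp_pos : 0 < ∑ j, Real.exp (z j) :=
  Finset.sum_pos (fun _ _ => Real.exp_pos _) Finset.univ_nonempty

theorem softmax_pos (i : Fin K) : 0 < softmax z i :=
  div_pos (Real.exp_pos _) (sum_exp_pos z)

theorem sum_softmax : ∑ i, softmax z i = 1 := by
  simp only [softmax, ← Finset.sum_div]
  exact div_self (sum_exp_pos z).ne'

theorem log_softmax (i : Fin K) :
    Real.log (softmax z i) = z i - Real.log (∑ j, Real.exp (z j)) := by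
  rw [softmax, Real.log_div (Real.exp_pos _).ne' (sum_exp_pos z).ne', Real.log_exp]

/-- The negative cross-entropy of `softmax (z / τ)` relative to a probability vector is affine
in the mean of `z`. -/
theorem sum_mul_log_softmax_div {p : Fin K → ℝ} (hp : ∑ i, p i = 1) (τ : ℝ) :
    ∑ i, p i * Real.log (softmax (fun i => z i / τ) i) =
      τ⁻¹ * ∑ i, p i * z i - Real.log (∑ j, Real.exp (z j / τ)) := by
  simp only [log_softmax, mul_sub, Finset.sum_sub_distrib, ← Finset.sum_mul, hp, one_mul,
    Finset.mul_sum]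
  congr 1
  exact Finset.sum_congr rfl fun i _ => by ring

end Softmax

theorem entropy_mono_in_temperature (K : ℕ) (hK : 1 ≤ K) (z : Fin K → ℝ)
    (τ₁ τ₂ : ℝ) (hτ₁ : 0 < τ₁) (hτ₁₂ : τ₁ ≤ τ₂) :
    shannonEntropy (softmax (fun i => z i / τ₁)) ≤
      shannonEntropy (softmax (fun i => z i / τ₂)) := by
  rcases hτ₁₂.eq_or_lt with rfl | hlt
  · exact le_rfl
  have : NeZero K := ⟨by omega⟩
  have hτ₂ : 0 < τ₂ := hτ₁.trans hlt
  have hinv : τ₂⁻¹ < τ₁⁻¹ := inv_strictAnti₀ hτ₁ hlt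
  have hp := sum_softmax fun i => z i / τ₁
  have hq := sum_softmax fun i => z i / τ₂
  have hpq := sum_mul_log_le_sum_mul_log_self (softmax_pos fun i => z i / τ₁)
    (softmax_pos fun i => z i / τ₂) (hp.trans hq.symm)
  have hqp := sum_mul_log_le_sum_mul_log_self (softmax_pos fun i => z i / τ₂)
    (softmax_pos fun i => z i / τ₁) (hq.trans hp.symm)
  unfold shannonEntropy
  rw [sum_mul_log_softmax_div z hp, sum_mul_log_softmax_div z hp] at hpq
  rw [sum_mul_log_softmax_div z hq, sum_mul_log_softmax_div z hq] at hqp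
  rw [sum_mul_log_softmax_div z hp, sum_mul_log_softmax_div z hq]
  have hmean : ∑ i, softmax (fun i => z i / τ₂) i * z i ≤
      ∑ i, softmax (fun i => z i / τ₁) i * z i := by
    refine le_of_mul_le_mul_left ?_ (sub_pos.2 hinv)
    linarith
  have := mul_le_mul_of_nonneg_left hmean (inv_pos.2 hτ₂).le
  linarith
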